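/- Let t > 0, ε > 0 and K > 0, with t − ε > 0. Let (N_n)_{n≥0} be a sequence of compact subsets of [0,1] with N₀ = [0,1], such that each N_n is a finite disjoint union of nondegenerate closed intervals N_{n,i}, N_{n+1} ⊂ N_n, and each component interval of N_{n+1} is contained in a component interval of N_n. Assume: (a) for every component interval N_{n,i} of N_n, every countable cover {U_k} of N_{n,i} ∩ N_{n+1} satisfies Σ_k |U_k|^t ≥ (1/(4K)) |N_{n,i}|^t; and (b) for every component N_{n,i} of N_n and every component N_{n+1,j} of N_{n+1}, |N_{n,i}|/|N_{n+1,j}| > (4K)^{1/ε}. Then the Hausdorff dimension of N = ⋂_n N_n is at least t − ε. -/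

import Mathlib

open MeasureTheory Filter Set
open scoped ENNReal NNReal

namespace S17

lemma three {a2 b2 x z a1 b1 a3 b3 y : ℝ}
    (d12 : Disjoint (Icc a1 b1) (Icc a2 b2)) (d23 : Disjoint (Icc a2 b2) (Icc a3 b3))
    (hx : x ∈ Icc a1 b1) (hy : y ∈ Icc a2 b2) (hz : z ∈ Icc a3 b3) (hxy : x < y) (hyz : y < z)
    (U : Set ℝ) (hxU : x ∈ U) (hzU : z ∈ U) : Metric.ediam (Icc a2 b2) ≤ Metric.ediam U := by
  have h1 : x ≤ a2 := by
    by_contra h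
    exact Set.disjoint_left.1 d12 hx ⟨by linarith, by linarith [hy.2]⟩
  have h3 : b2 ≤ z := by
    by_contra h
    exact Set.disjoint_left.1 d23 ⟨by linarith [hy.1], by linarith⟩ hz
  rw [Real.ediam_Icc]
  refine le_trans ?_ (Metric.edist_le_ediam_of_mem hzU hxU)
  rw [edist_dist, Real.dist_eq]
  apply ENNReal.ofReal_le_ofReal
  exact le_trans (by linarith) (le_abs_self _)

lemma card_le_two (l u : ℕ → ℝ) (m : ℕ) (U : Set ℝ) (S : Finset ℕ)
    (hlu : ∀ i < m, l i < u i)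
    (hdisj : ∀ i < m, ∀ j < m, i ≠ j → Disjoint (Icc (l i) (u i)) (Icc (l j) (u j)))
    (hS : ∀ i ∈ S, i < m ∧ (U ∩ Icc (l i) (u i)).Nonempty ∧
      Metric.ediam U < Metric.ediam (Icc (l i) (u i))) : S.card ≤ 2 := by
  by_contra hc
  push Not at hc
  obtain ⟨a, ha, b, hb, c, hc, hab, hac, hbc⟩ := Finset.two_lt_card.1 hc
  have key : ∀ p ∈ S, ∀ q ∈ S, ∀ r ∈ S, p ≠ q → q ≠ r → ∀ x ∈ U ∩ Icc (l p) (u p),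
      ∀ y ∈ U ∩ Icc (l q) (u q), ∀ z ∈ U ∩ Icc (l r) (u r), x < y → y < z → False := by
    intro p hp q hq r hr hpq hqr x hx y hy z hz hxy hyz
    have := three (hdisj p (hS p hp).1 q (hS q hq).1 hpq)
      (hdisj q (hS q hq).1 r (hS r hr).1 hqr) hx.2 hy.2 hz.2 hxy hyz U hx.1 hz.1
    exact absurd (hS q hq).2.2 (not_lt.2 this)
  have ne : ∀ p ∈ S, ∀ q ∈ S, p ≠ q → ∀ x ∈ U ∩ Icc (l p) (u p),
      ∀ y ∈ U ∩ Icc (l q) (u q), x ≠ y := by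
    rintro p hp q hq hpq x hx y hy rfl
    exact Set.disjoint_left.1 (hdisj p (hS p hp).1 q (hS q hq).1 hpq) hx.2 hy.2
  obtain ⟨x, hx⟩ := (hS a ha).2.1
  obtain ⟨y, hy⟩ := (hS b hb).2.1
  obtain ⟨z, hz⟩ := (hS c hc).2.1
  rcases lt_or_gt_of_ne (ne a ha b hb hab x hx y hy) with h1 | h1 <;>
  rcases lt_or_gt_of_ne (ne a ha c hc hac x hx z hz) with h2 | h2 <;>
  rcases lt_or_gt_of_ne (ne b hb c hc hbc y hy z hz) with h3 | h3
  · exact key a ha b hb c hc hab hbc x hx y hy z hz h1 h3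
  · exact key a ha c hc b hb hac hbc.symm x hx z hz y hy h2 h3
  · linarith
  · exact key c hc a ha b hb hac.symm hab z hz x hx y hy h2 h1
  · exact key b hb a ha c hc hab.symm hac y hy x hx z hz h1 h2
  · linarith
  · exact key b hb c hc a ha hbc hac.symm y hy z hz x hx h3 h2
  · exact key c hc b hb a ha hbc.symm hab.symm z hz y hy x hx h3 h1

open Classical in
lemma core (t ε s : ℝ) (hε : 0 < ε) (hs : 0 < s) (hs1 : s ≤ 1) (hts : t = s + ε) (q : ℝ≥0∞)
    (ι : ℕ → ℕ) (l u : ℕ → ℕ → ℝ)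
    (hι : ∀ n, 0 < ι n)
    (hlu : ∀ n, ∀ i < ι n, l n i < u n i)
    (hdisj : ∀ n, ∀ i < ι n, ∀ j < ι n, i ≠ j →
      Disjoint (Icc (l n i) (u n i)) (Icc (l n j) (u n j)))
    (N : ℕ → Set ℝ)
    (hN : ∀ n, N n = ⋃ i ∈ Finset.range (ι n), Icc (l n i) (u n i))
    (hcomp : ∀ n, ∀ j < ι (n + 1), ∃ i < ι n,
      Icc (l (n + 1) j) (u (n + 1) j) ⊆ Icc (l n i) (u n i))
    (hcover : ∀ n, ∀ i < ι n, ∀ V : ℕ ⊕ ℕ → Set ℝ,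
      Icc (l n i) (u n i) ∩ N (n + 1) ⊆ ⋃ k, V k →
      Metric.ediam (Icc (l n i) (u n i)) ^ t ≤ q * ∑' k, Metric.ediam (V k) ^ t)
    (hratio : ∀ n, ∀ i < ι n, ∀ j < ι (n + 1),
      q * Metric.ediam (Icc (l (n+1) j) (u (n+1) j)) ^ ε ≤ Metric.ediam (Icc (l n i) (u n i)) ^ ε)
    (hmono : ∀ n, ∀ i < ι n, ∀ j < ι (n + 1),
      Metric.ediam (Icc (l (n+1) j) (u (n+1) j)) ≤ Metric.ediam (Icc (l n i) (u n i)))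
    (U : ℕ → Set ℝ) (M : ℕ) (hU : N M ⊆ ⋃ k, U k) :
    Metric.ediam (Icc (l 0 0) (u 0 0)) ^ s ≤
      (q * 3 ^ t * 4 + 2) * ∑' k, Metric.ediam (U k) ^ s := by
  set I : ℕ → ℕ → Set ℝ := fun n i => Icc (l n i) (u n i) with hI
  set D : ℕ → ℕ → ℝ≥0∞ := fun n i => Metric.ediam (I n i) with hD
  set d : ℕ → ℝ≥0∞ := fun k => Metric.ediam (U k) with hd
  change D 0 0 ^ s ≤ (q * 3 ^ t * 4 + 2) * ∑' k, d k ^ s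
  have hDv : ∀ n i, D n i = ENNReal.ofReal (u n i - l n i) := fun n i => Real.ediam_Icc _ _
  have hD0 : ∀ n, ∀ i < ι n, D n i ≠ 0 := by
    intro n i hi
    rw [hDv]
    simpa using hlu n i hi
  have hDT : ∀ n i, D n i ≠ ⊤ := by
    intro n i
    rw [hDv]
    exact ENNReal.ofReal_ne_top
  have ht : 0 < t := by linarith
  -- good components
  set G : ℕ → Finset ℕ := fun n => (Finset.range (ι n)).filter
    (fun i => ∀ k, (U k ∩ I n i).Nonempty → d k < D n i) with hG
  have hGm : ∀ n i, i ∈ G n ↔ i < ι n ∧ ∀ k, (U k ∩ I n i).Nonempty → d k < D n i := by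
    intro n i
    simp [hG]
  set act : ℕ → ℕ → ℕ → Prop := fun n i k => ∃ j < ι (n+1), I (n+1) j ⊆ I n i ∧
    (U k ∩ I (n+1) j).Nonempty ∧ D (n+1) j ≤ d k with hact
  set W : ℕ → ℝ≥0∞ := fun n => ∑ i ∈ G n, D n i ^ s with hW
  set e : ℕ → ℕ → ℝ≥0∞ := fun n k => ∑ i ∈ G n, if act n i k then d k ^ s else 0 with he
  have uniq : ∀ n, ∀ i < ι n, ∀ i' < ι n, ∀ x, x ∈ I n i → x ∈ I n i' → i = i' := by
    intro n i hi i' hi' x hx hx'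
    by_contra hne
    exact Set.disjoint_left.1 (hdisj n i hi i' hi' hne) hx hx'
  -- the single-interval step
  have step1 : ∀ n, ∀ i ∈ G n, D n i ^ s ≤
      q * 3 ^ t * (∑' k, if act n i k then d k ^ s else 0) +
      ∑ j ∈ G (n+1), if I (n+1) j ⊆ I n i then D (n+1) j ^ s else 0 := by
    intro n i hiG
    obtain ⟨hi, hgood⟩ := (hGm n i).1 hiG
    set T : ℕ → Set ℝ := fun k => {x | ∃ j < ι (n+1), I (n+1) j ⊆ I n i ∧
      (U k ∩ I (n+1) j).Nonempty ∧ D (n+1) j ≤ d k ∧ x ∈ I (n+1) j} with hT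
    set J : ℕ → Set ℝ := fun j => if j ∈ G (n+1) ∧ I (n+1) j ⊆ I n i then I (n+1) j else ∅ with hJ
    have hc := hcover n i hi (Sum.elim T J) (by
      rintro x ⟨hx, hxN⟩
      rw [hN] at hxN
      simp only [mem_iUnion, Finset.mem_range] at hxN
      obtain ⟨j, hj, hxj⟩ := hxN
      obtain ⟨i', hi', hsub⟩ := hcomp n j hj
      obtain rfl := uniq n i hi i' hi' x hx (hsub hxj)
      rw [mem_iUnion]
      by_cases hjG : j ∈ G (n+1)
      · refine ⟨Sum.inr j, ?_⟩
        have : j ∈ G (n+1) ∧ I (n+1) j ⊆ I n i := ⟨hjG, hsub⟩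
        simp only [Sum.elim_inr, hJ, if_pos this]
        exact hxj
      · rw [hGm] at hjG
        push Not at hjG
        obtain ⟨k, hk, hle⟩ := hjG hj
        exact ⟨Sum.inl k, j, hj, hsub, hk, hle, hxj⟩)
    rw [Summable.tsum_sum ENNReal.summable ENNReal.summable] at hc
    simp only [Sum.elim_inl, Sum.elim_inr] at hc
    have hTb : ∀ k, Metric.ediam (T k) ^ t ≤
        3 ^ t * (if act n i k then d k ^ s else 0) * D n i ^ ε := by
      intro k
      by_cases ha : act n i k
      · rw [if_pos ha]
        have h3 : Metric.ediam (T k) ≤ 3 * d k := by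
          apply Metric.ediam_le
          rintro x ⟨j, hj, -, ⟨p, hpU, hp⟩, hjd, hx⟩ y ⟨j', hj', -, ⟨r, hrU, hr⟩, hjd', hy⟩
          calc edist x y ≤ edist x p + edist p r + edist r y := edist_triangle4 _ _ _ _
            _ ≤ d k + d k + d k := by
              gcongr
              · exact (Metric.edist_le_ediam_of_mem hx hp).trans hjd
              · exact Metric.edist_le_ediam_of_mem hpU hrU
              · exact (Metric.edist_le_ediam_of_mem hr hy).trans hjd'
            _ = 3 * d k := by ring
        have hdk : d k ≤ D n i := by
          obtain ⟨j, hj, hsub, hne, -⟩ := ha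
          exact (hgood k (hne.mono (inter_subset_inter_right _ hsub))).le
        calc Metric.ediam (T k) ^ t ≤ (3 * d k) ^ t := ENNReal.rpow_le_rpow h3 ht.le
          _ = 3 ^ t * (d k ^ s * d k ^ ε) := by
            rw [ENNReal.mul_rpow_of_nonneg _ _ ht.le, ← ENNReal.rpow_add_of_nonneg _ _ hs.le hε.le,
              hts]
          _ ≤ 3 ^ t * (d k ^ s * D n i ^ ε) := by gcongr
          _ = _ := by ring
      · have : T k = ∅ := by
          rw [Set.eq_empty_iff_forall_notMem]
          rintro x ⟨j, hj, h1, h2, h3, -⟩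
          exact ha ⟨j, hj, h1, h2, h3⟩
        rw [this, Metric.ediam_empty, ENNReal.zero_rpow_of_pos ht]
        exact zero_le
    have hJb : q * ∑' j, Metric.ediam (J j) ^ t ≤
        (∑ j ∈ G (n+1), if I (n+1) j ⊆ I n i then D (n+1) j ^ s else 0) * D n i ^ ε := by
      rw [tsum_eq_sum (s := G (n+1)), Finset.mul_sum, Finset.sum_mul]
      · apply Finset.sum_le_sum
        intro j hj
        by_cases hsub : I (n+1) j ⊆ I n i
        · have : j ∈ G (n+1) ∧ I (n+1) j ⊆ I n i := ⟨hj, hsub⟩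
          simp only [hJ, if_pos this, if_pos hsub]
          change q * D (n+1) j ^ t ≤ _
          rw [hts, ENNReal.rpow_add_of_nonneg _ _ hs.le hε.le]
          calc q * (D (n+1) j ^ s * D (n+1) j ^ ε) = D (n+1) j ^ s * (q * D (n+1) j ^ ε) := by ring
            _ ≤ _ := by
              gcongr
              exact hratio n i hi j ((hGm _ _).1 hj).1
        · simp [hJ, hsub, ht]
      · intro j hj
        simp [hJ, hj, ht]
    have hε0 : D n i ^ ε ≠ 0 := by
      simp [ENNReal.rpow_eq_zero_iff, hD0 n i hi, hDT n i]
    have hεT : D n i ^ ε ≠ ⊤ := ENNReal.rpow_ne_top_of_nonneg hε.le (hDT n i)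
    rw [← ENNReal.mul_le_mul_iff_left hε0 hεT]
    calc D n i ^ s * D n i ^ ε = D n i ^ t := by
          rw [hts, ENNReal.rpow_add_of_nonneg _ _ hs.le hε.le]
      _ ≤ _ := hc
      _ = q * ∑' k, Metric.ediam (T k) ^ t + q * ∑' j, Metric.ediam (J j) ^ t := by rw [mul_add]
      _ ≤ q * ∑' k, 3 ^ t * (if act n i k then d k ^ s else 0) * D n i ^ ε +
          (∑ j ∈ G (n+1), if I (n+1) j ⊆ I n i then D (n+1) j ^ s else 0) * D n i ^ ε := by
        gcongr with k
        exact hTb k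
      _ = _ := by
        rw [ENNReal.tsum_mul_right, ENNReal.tsum_mul_left]
        ring
  have step : ∀ n, W n ≤ q * 3 ^ t * ∑' k, e n k + W (n+1) := by
    intro n
    calc W n ≤ ∑ i ∈ G n, (q * 3 ^ t * (∑' k, if act n i k then d k ^ s else 0) +
      ∑ j ∈ G (n+1), if I (n+1) j ⊆ I n i then D (n+1) j ^ s else 0) :=
          Finset.sum_le_sum (step1 n)
      _ = q * 3 ^ t * ∑' k, e n k +
          ∑ j ∈ G (n+1), ∑ i ∈ G n, if I (n+1) j ⊆ I n i then D (n+1) j ^ s else 0 := by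
        rw [Finset.sum_add_distrib, ← Finset.mul_sum, Finset.sum_comm,
          Summable.tsum_finsetSum (fun _ _ => ENNReal.summable)]
      _ ≤ _ := by
        gcongr
        apply Finset.sum_le_sum
        intro j hj
        rw [← Finset.sum_filter, Finset.sum_const]
        have : ((G n).filter (fun i => I (n+1) j ⊆ I n i)).card ≤ 1 := by
          rw [Finset.card_le_one]
          intro a ha b hb
          rw [Finset.mem_filter] at ha hb
          have hx : l (n+1) j ∈ I (n+1) j :=
            left_mem_Icc.2 (hlu (n+1) j ((hGm _ _).1 hj).1).le
          exact uniq n a ((hGm _ _).1 ha.1).1 b ((hGm _ _).1 hb.1).1 _ (ha.2 hx) (hb.2 hx)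
        calc _ ≤ 1 • D (n+1) j ^ s := by
              rw [nsmul_eq_mul, nsmul_eq_mul]
              gcongr
          _ = _ := one_nsmul _
  have tele : ∀ m, W 0 ≤ q * 3 ^ t * ∑' k, ∑ n ∈ Finset.range m, e n k + W m := by
    intro m
    induction m with
    | zero => simp
    | succ m ih =>
      refine ih.trans ?_
      calc _ ≤ q * 3 ^ t * ∑' k, ∑ n ∈ Finset.range m, e n k +
            (q * 3 ^ t * ∑' k, e m k + W (m+1)) := by
            gcongr
            exact step m
        _ = _ := by
          simp only [Finset.sum_range_succ]
          rw [ENNReal.tsum_add]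
          ring
  have two : ∀ n k (S : Finset ℕ), S ⊆ G n → (∀ i ∈ S, (U k ∩ I n i).Nonempty) →
      S.card ≤ 2 := by
    intro n k S hSG hSU
    apply card_le_two (l n) (u n) (ι n) (U k) S (hlu n) (hdisj n)
    intro i hi
    have := (hGm n i).1 (hSG hi)
    exact ⟨this.1, hSU i hi, this.2 k (hSU i hi)⟩
  have actmeet : ∀ n i k, act n i k → (U k ∩ I n i).Nonempty := by
    rintro n i k ⟨j, hj, hsub, hne, -⟩
    exact hne.mono (inter_subset_inter_right _ hsub)
  have e2 : ∀ n k, e n k ≤ 2 * d k ^ s := by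
    intro n k
    simp only [he]
    rw [← Finset.sum_filter, Finset.sum_const, nsmul_eq_mul]
    gcongr
    have := two n k ((G n).filter (fun i => act n i k)) (Finset.filter_subset _ _)
      (fun i hi => actmeet n i k (Finset.mem_filter.1 hi).2)
    exact_mod_cast this
  have hmono2 : ∀ n m, n < m → ∀ i < ι n, ∀ j < ι m, D m j ≤ D n i := by
    intro n m hnm
    induction m, hnm using Nat.le_induction with
    | base => exact hmono n
    | succ m hm ih =>
      intro i hi j hj
      exact (hmono m 0 (hι m) j hj).trans (ih i hi 0 (hι m))
  have e4 : ∀ k, ∑ n ∈ Finset.range M, e n k ≤ 4 * d k ^ s := by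
    intro k
    have hex : ∀ n, e n k ≠ 0 → ∃ i ∈ G n, act n i k := by
      intro n hn
      obtain ⟨i, hi, hne⟩ := Finset.exists_ne_zero_of_sum_ne_zero hn
      exact ⟨i, hi, by by_contra h; simp [h] at hne⟩
    have hclose : ∀ n m, e n k ≠ 0 → e m k ≠ 0 → m ≤ n + 1 := by
      intro n m hn hm
      by_contra hlt
      obtain ⟨i, hi, j, hj, -, -, hle⟩ := hex n hn
      obtain ⟨i', hi', ha⟩ := hex m hm
      have h1 := ((hGm _ _).1 hi').2 k (actmeet _ _ _ ha)
      have h2 := hmono2 (n+1) m (by omega) j hj i' ((hGm _ _).1 hi').1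
      exact absurd (h1.trans_le (h2.trans hle)) (lt_irrefl _)
    by_cases h0 : ∃ n, e n k ≠ 0
    · have hsp := Nat.find_spec h0
      set n0 := Nat.find h0
      have hsub : ∀ n, e n k ≠ 0 → n ∈ ({n0, n0+1} : Finset ℕ) := by
        intro n hn
        have h1 := hclose n0 n hsp hn
        have h2 : n0 ≤ n := Nat.find_min' h0 hn
        simp only [Finset.mem_insert, Finset.mem_singleton]
        omega
      calc ∑ n ∈ Finset.range M, e n k ≤ ∑ n ∈ ({n0, n0+1} : Finset ℕ), e n k := by
            apply Finset.sum_le_sum_of_ne_zero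
            intro n _ hn
            exact hsub n hn
        _ = e n0 k + e (n0+1) k := Finset.sum_pair (by omega)
        _ ≤ 2 * d k ^ s + 2 * d k ^ s := add_le_add (e2 _ _) (e2 _ _)
        _ = 4 * d k ^ s := by ring
    · push Not at h0
      simp [h0]
  -- the last level
  have last : W M ≤ 2 * ∑' k, d k ^ s := by
    have h1 : ∀ i ∈ G M, D M i ^ s ≤ ∑' k, if (U k ∩ I M i).Nonempty then d k ^ s else 0 := by
      intro i hiG
      obtain ⟨hi, hgood⟩ := (hGm M i).1 hiG
      rw [← ENNReal.mul_le_mul_iff_left (hD0 M i hi) (hDT M i)]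
      have hvol : D M i ≤ ∑' k, if (U k ∩ I M i).Nonempty then d k else 0 := by
        have : I M i ⊆ ⋃ k, (U k ∩ I M i) := by
          intro x hx
          have : x ∈ N M := by
            rw [hN]
            simp only [mem_iUnion, Finset.mem_range]
            exact ⟨i, hi, hx⟩
          obtain ⟨k, hk⟩ := mem_iUnion.1 (hU this)
          exact mem_iUnion.2 ⟨k, hk, hx⟩
        calc D M i = volume (I M i) := by rw [hDv, hI, Real.volume_Icc]
          _ ≤ volume (⋃ k, (U k ∩ I M i)) := measure_mono this
          _ ≤ ∑' k, volume (U k ∩ I M i) := measure_iUnion_le _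
          _ ≤ _ := by
            apply ENNReal.tsum_le_tsum
            intro k
            split_ifs with h
            · exact (measure_mono inter_subset_left).trans (Real.volume_le_diam _)
            · rw [not_nonempty_iff_eq_empty.1 h]
              simp
      calc D M i ^ s * D M i ≤
            D M i ^ s * ∑' k, if (U k ∩ I M i).Nonempty then d k else 0 := by gcongr
        _ = ∑' k, D M i ^ s * if (U k ∩ I M i).Nonempty then d k else 0 :=
            ENNReal.tsum_mul_left.symm
        _ ≤ ∑' k, (if (U k ∩ I M i).Nonempty then d k ^ s else 0) * D M i := by
          apply ENNReal.tsum_le_tsum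
          intro k
          split_ifs with h
          · have split : ∀ x : ℝ≥0∞, x = x ^ s * x ^ (1 - s) := by
              intro x
              rw [← ENNReal.rpow_add_of_nonneg _ _ hs.le (by linarith)]
              simp
            calc D M i ^ s * d k = D M i ^ s * (d k ^ s * d k ^ (1 - s)) := by rw [← split]
              _ ≤ D M i ^ s * (d k ^ s * D M i ^ (1 - s)) := by
                gcongr
                exact (hgood k h).le
              _ = d k ^ s * (D M i ^ s * D M i ^ (1 - s)) := by ring
              _ = _ := by rw [← split]
          · simp
        _ = _ := ENNReal.tsum_mul_right
    calc W M ≤ ∑ i ∈ G M, ∑' k, (if (U k ∩ I M i).Nonempty then d k ^ s else 0) :=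
          Finset.sum_le_sum h1
      _ = ∑' k, ∑ i ∈ G M, (if (U k ∩ I M i).Nonempty then d k ^ s else 0) :=
          (Summable.tsum_finsetSum (fun _ _ => ENNReal.summable)).symm
      _ ≤ ∑' k, 2 * d k ^ s := by
        apply ENNReal.tsum_le_tsum
        intro k
        rw [← Finset.sum_filter, Finset.sum_const, nsmul_eq_mul]
        gcongr
        have := two M k ((G M).filter (fun i => (U k ∩ I M i).Nonempty)) (Finset.filter_subset _ _)
          (fun i hi => (Finset.mem_filter.1 hi).2)
        exact_mod_cast this
      _ = _ := ENNReal.tsum_mul_left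
  by_cases h0 : 0 ∈ G 0
  · calc D 0 0 ^ s ≤ W 0 := Finset.single_le_sum (f := fun i => D 0 i ^ s)
          (fun _ _ => zero_le) h0
      _ ≤ _ := tele M
      _ ≤ q * 3 ^ t * ∑' k, 4 * d k ^ s + 2 * ∑' k, d k ^ s := by
        gcongr with k
        exact e4 k
      _ = _ := by
        rw [ENNReal.tsum_mul_left]
        ring
  · rw [hGm] at h0
    push Not at h0
    obtain ⟨k, -, hk⟩ := h0 (hι 0)
    calc D 0 0 ^ s ≤ d k ^ s := ENNReal.rpow_le_rpow hk hs.le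
      _ ≤ ∑' k, d k ^ s := ENNReal.le_tsum k
      _ = 1 * ∑' k, d k ^ s := (one_mul _).symm
      _ ≤ _ := by
        gcongr
        exact le_trans (by norm_num) le_add_self

end S17

theorem stmt_17
    (t ε K : ℝ) (ht : 0 < t) (hε : 0 < ε) (hK : 0 < K) (htε : 0 < t - ε)
    -- the nested sequence of sets N n, each a finite disjoint union of
    -- nondegenerate closed intervals [l n i, u n i], i < ι n
    (ι : ℕ → ℕ) (hι : ∀ n, 0 < ι n)
    (l u : ℕ → ℕ → ℝ)
    (hlu : ∀ n, ∀ i < ι n, l n i < u n i)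
    (hdisj : ∀ n, ∀ i < ι n, ∀ j < ι n, i ≠ j →
      Disjoint (Set.Icc (l n i) (u n i)) (Set.Icc (l n j) (u n j)))
    (N : ℕ → Set ℝ)
    (hN : ∀ n, N n = ⋃ i ∈ Finset.range (ι n), Set.Icc (l n i) (u n i))
    (hN0 : N 0 = Set.Icc (0:ℝ) 1)
    (hNsub : ∀ n, N (n + 1) ⊆ N n)
    (hcomp : ∀ n, ∀ j < ι (n + 1), ∃ i < ι n,
      Set.Icc (l (n + 1) j) (u (n + 1) j) ⊆ Set.Icc (l n i) (u n i))
    -- (a) covers of N_{n,i} ∩ N_{n+1} are large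
    (hcover : ∀ n, ∀ i < ι n, ∀ U : ℕ → Set ℝ,
      Set.Icc (l n i) (u n i) ∩ N (n + 1) ⊆ ⋃ k, U k →
      ENNReal.ofReal (1 / (4 * K) * (u n i - l n i) ^ t) ≤
        ∑' k, EMetric.diam (U k) ^ t)
    -- (b) the intervals of N_{n+1} are much smaller than those of N n
    (hratio : ∀ n, ∀ i < ι n, ∀ j < ι (n + 1),
      (u n i - l n i) / (u (n + 1) j - l (n + 1) j) > (4 * K) ^ (1 / ε)) :
    ENNReal.ofReal (t - ε) ≤ dimH (⋂ n, N n) := by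
  have hdiam : ∀ A : Set ℝ, EMetric.diam A = Metric.ediam A := fun A => rfl
  simp only [hdiam] at hcover
  have h4K : 0 < 4 * K := by linarith
  set q : ℝ≥0∞ := ENNReal.ofReal (4 * K) with hq
  have hq0 : q ≠ 0 := by simpa [hq] using hK
  have hDv : ∀ n i, Metric.ediam (Icc (l n i) (u n i)) = ENNReal.ofReal (u n i - l n i) :=
    fun n i => Real.ediam_Icc _ _
  have hpos : ∀ n, ∀ i < ι n, 0 < u n i - l n i := fun n i hi => sub_pos.2 (hlu n i hi)
  -- the cover hypothesis, for covers indexed by ℕ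
  have hcovN : ∀ n, ∀ i < ι n, ∀ V : ℕ → Set ℝ,
      Icc (l n i) (u n i) ∩ N (n + 1) ⊆ ⋃ k, V k →
      Metric.ediam (Icc (l n i) (u n i)) ^ t ≤ q * ∑' k, Metric.ediam (V k) ^ t := by
    intro n i hi V hV
    calc Metric.ediam (Icc (l n i) (u n i)) ^ t
        = q * ENNReal.ofReal (1 / (4 * K) * (u n i - l n i) ^ t) := by
          rw [hDv, hq, ← ENNReal.ofReal_mul h4K.le, ENNReal.ofReal_rpow_of_pos (hpos n i hi)]
          congr 1
          field_simp
      _ ≤ _ := by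
        gcongr
        exact hcover n i hi V hV
  have hcovS : ∀ n, ∀ i < ι n, ∀ V : ℕ ⊕ ℕ → Set ℝ,
      Icc (l n i) (u n i) ∩ N (n + 1) ⊆ ⋃ k, V k →
      Metric.ediam (Icc (l n i) (u n i)) ^ t ≤ q * ∑' k, Metric.ediam (V k) ^ t := by
    intro n i hi V hV
    have h := hcovN n i hi (fun k => ⋃ b ∈ Encodable.decode₂ (ℕ ⊕ ℕ) k, V b) (by
      rw [Encodable.iUnion_decode₂]
      exact hV)
    rwa [tsum_iUnion_decode₂ (fun A : Set ℝ => Metric.ediam A ^ t) (by simp [ht])] at h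
  have hlt : ∀ n, ∀ i < ι n, Metric.ediam (Icc (l n i) (u n i)) ^ t ≠ 0 ∧
      Metric.ediam (Icc (l n i) (u n i)) ^ t ≠ ⊤ := by
    intro n i hi
    rw [hDv, ENNReal.ofReal_rpow_of_pos (hpos n i hi)]
    refine ⟨?_, ENNReal.ofReal_ne_top⟩
    have := Real.rpow_pos_of_pos (hpos n i hi) t
    simpa using this
  -- 4K ≥ 1
  have hK1 : 1 ≤ 4 * K := by
    have h := hcovN 0 0 (hι 0) (fun k => if k = 0 then Icc (l 0 0) (u 0 0) else ∅) (by
      intro x hx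
      exact mem_iUnion.2 ⟨0, by simpa using hx.1⟩)
    rw [tsum_eq_single 0 (by intro k hk; simp [hk, ht])] at h
    simp only [if_true] at h
    obtain ⟨h1, h2⟩ := hlt 0 0 (hι 0)
    have h3 : 1 * Metric.ediam (Icc (l 0 0) (u 0 0)) ^ t ≤
      q * Metric.ediam (Icc (l 0 0) (u 0 0)) ^ t := by rwa [one_mul]
    rw [ENNReal.mul_le_mul_iff_left h1 h2] at h3
    exact ENNReal.one_le_ofReal.1 h3
  -- t ≤ 1
  have ht1 : t ≤ 1 := by
    by_contra hgt
    push Not at hgt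
    have hz : μH[t] (Icc (l 0 0) (u 0 0)) = 0 := by
      have := hausdorffMeasure_of_dimH_lt (s := Icc (l 0 0) (u 0 0)) (d := ⟨t, ht.le⟩) (by
        refine lt_of_le_of_lt (dimH_mono (subset_univ _)) ?_
        rw [Real.dimH_univ]
        exact ENNReal.one_lt_coe_iff.2 (show (1 : ℝ≥0) < ⟨t, ht.le⟩ from hgt))
      exact this
    rw [Measure.hausdorffMeasure_apply] at hz
    obtain ⟨h1, h2⟩ := hlt 0 0 (hι 0)
    have hc0 : Metric.ediam (Icc (l 0 0) (u 0 0)) ^ t / q ≠ 0 :=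
      ENNReal.div_ne_zero.2 ⟨h1, ENNReal.ofReal_ne_top⟩
    have hle : Metric.ediam (Icc (l 0 0) (u 0 0)) ^ t / q ≤ 0 := by
      rw [← hz]
      refine le_iSup₂_of_le 1 one_pos ?_
      refine le_iInf fun V => le_iInf fun hV => le_iInf fun _ => ?_
      refine ENNReal.div_le_of_le_mul' ?_
      refine (hcovN 0 0 (hι 0) V (inter_subset_left.trans hV)).trans ?_
      gcongr with k
      rcases (V k).eq_empty_or_nonempty with h | h
      · simp [h, ht]
      · simp [h]
    exact hc0 (le_antisymm hle zero_le)
  have hroot : 1 ≤ (4 * K) ^ (1 / ε) := Real.one_le_rpow hK1 (by positivity)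
  have hmono : ∀ n, ∀ i < ι n, ∀ j < ι (n + 1),
      Metric.ediam (Icc (l (n+1) j) (u (n+1) j)) ≤ Metric.ediam (Icc (l n i) (u n i)) := by
    intro n i hi j hj
    rw [hDv, hDv]
    apply ENNReal.ofReal_le_ofReal
    have h := hroot.trans (hratio n i hi j hj).le
    rwa [one_le_div (hpos _ _ hj)] at h
  have hrat : ∀ n, ∀ i < ι n, ∀ j < ι (n + 1),
      q * Metric.ediam (Icc (l (n+1) j) (u (n+1) j)) ^ ε ≤
        Metric.ediam (Icc (l n i) (u n i)) ^ ε := by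
    intro n i hi j hj
    rw [hDv, hDv, ENNReal.ofReal_rpow_of_pos (hpos _ _ hi), ENNReal.ofReal_rpow_of_pos (hpos _ _ hj),
      hq, ← ENNReal.ofReal_mul h4K.le]
    apply ENNReal.ofReal_le_ofReal
    have h := (hratio n i hi j hj).le
    rw [le_div_iff₀ (hpos _ _ hj)] at h
    have h2 := Real.rpow_le_rpow (mul_nonneg (by linarith) (hpos _ _ hj).le) h hε.le
    rwa [Real.mul_rpow (by linarith) (hpos _ _ hj).le, ← Real.rpow_mul h4K.le,
      one_div_mul_cancel hε.ne', Real.rpow_one] at h2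
  set s : ℝ := t - ε with hs
  have hcore := S17.core t ε s hε htε (by linarith) (by rw [hs]; ring) q ι l u hι hlu hdisj N hN
    hcomp hcovS hrat hmono
  set C : ℝ≥0∞ := q * 3 ^ t * 4 + 2 with hC
  have hCT : C ≠ ⊤ := by
    have h3 : (3 : ℝ≥0∞) ^ t ≠ ⊤ := ENNReal.rpow_ne_top_of_nonneg ht.le (by simp)
    exact ENNReal.add_ne_top.2
      ⟨ENNReal.mul_ne_top (ENNReal.mul_ne_top ENNReal.ofReal_ne_top h3) (by simp), by simp⟩
  set c : ℝ≥0∞ := Metric.ediam (Icc (l 0 0) (u 0 0)) ^ s with hc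
  have hc0 : c ≠ 0 := by
    rw [hc, hDv, ENNReal.ofReal_rpow_of_pos (hpos 0 0 (hι 0))]
    have := Real.rpow_pos_of_pos (hpos 0 0 (hι 0)) s
    simpa using this
  -- compactness
  have hcpt : ∀ n, IsCompact (N n) := by
    intro n
    rw [hN]
    exact (Finset.range (ι n)).isCompact_biUnion fun i _ => isCompact_Icc
  have hanti : Antitone N := antitone_nat_of_succ_le hNsub
  have hopen : ∀ V : ℕ → Set ℝ, (∀ k, IsOpen (V k)) → (⋂ n, N n) ⊆ ⋃ k, V k →
      c ≤ C * ∑' k, Metric.ediam (V k) ^ s := by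
    intro V hVo hV
    obtain ⟨M, hM⟩ := exists_subset_nhds_of_isCompact' (V := N) hanti.directed_ge hcpt
      (fun n => (hcpt n).isClosed) (U := ⋃ k, V k)
      (fun x hx => (isOpen_iUnion hVo).mem_nhds (hV hx))
    exact hcore V M hM
  have hfat : ∀ A : Set ℝ, Metric.ediam A ≠ ⊤ → ∀ κ : ℝ≥0, 0 < κ → ∃ B : Set ℝ, IsOpen B ∧ A ⊆ B ∧
      Metric.ediam B ^ s ≤ Metric.ediam A ^ s + κ := by
    intro A hA κ hκ
    have hcont : Continuous fun δ : ℝ≥0 => (Metric.ediam A + 2 * (δ : ℝ≥0∞)) ^ s := by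
      refine (ENNReal.continuous_rpow_const).comp ?_
      exact continuous_const.add
        ((ENNReal.continuous_const_mul (by simp)).comp ENNReal.continuous_coe)
    have hlt : (Metric.ediam A + 2 * ((0 : ℝ≥0) : ℝ≥0∞)) ^ s < Metric.ediam A ^ s + κ := by
      simp only [ENNReal.coe_zero, mul_zero, add_zero]
      exact ENNReal.lt_add_right (ENNReal.rpow_ne_top_of_nonneg htε.le hA) (by simpa using hκ.ne')
    have hev := hcont.continuousAt.eventually_lt (continuousAt_const (x := (0 : ℝ≥0))) hlt
    have hev2 : ∀ᶠ δ : ℝ≥0 in nhdsWithin 0 (Ioi 0),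
        (Metric.ediam A + 2 * (δ : ℝ≥0∞)) ^ s < Metric.ediam A ^ s + κ :=
      hev.filter_mono nhdsWithin_le_nhds
    obtain ⟨δ, hδ, hδ0⟩ := (hev2.and self_mem_nhdsWithin).exists
    refine ⟨Metric.thickening δ A, Metric.isOpen_thickening,
      Metric.self_subset_thickening (by exact_mod_cast hδ0) A, ?_⟩
    exact (ENNReal.rpow_le_rpow (Metric.ediam_thickening_le δ) htε.le).trans hδ.le
  have hmeas : c / C ≤ μH[s] (⋂ n, N n) := by
    rw [Measure.hausdorffMeasure_apply]
    refine le_iSup₂_of_le 1 one_pos ?_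
    refine le_iInf fun V => le_iInf fun hV => le_iInf fun hV1 => ?_
    refine ENNReal.le_of_forall_pos_le_add fun κ hκ _ => ?_
    obtain ⟨κ', hκ', hsum⟩ := ENNReal.exists_pos_sum_of_countable
      (ε := (κ : ℝ≥0∞)) (by simpa using hκ.ne') ℕ
    choose B hBo hAB hB using fun k =>
      hfat (V k) (ne_top_of_le_ne_top ENNReal.one_ne_top (hV1 k)) (κ' k) (hκ' k)
    refine ENNReal.div_le_of_le_mul' ?_
    refine (hopen B hBo (hV.trans (iUnion_mono hAB))).trans ?_
    gcongr
    calc ∑' k, Metric.ediam (B k) ^ s ≤ ∑' k, (Metric.ediam (V k) ^ s + κ' k) :=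
          ENNReal.tsum_le_tsum hB
      _ = ∑' k, Metric.ediam (V k) ^ s + ∑' k, (κ' k : ℝ≥0∞) := ENNReal.tsum_add
      _ ≤ _ := by
        refine add_le_add (ENNReal.tsum_le_tsum fun k => ?_) hsum.le
        rcases (V k).eq_empty_or_nonempty with h | h
        · simp [h, htε]
        · simp [h]
  have hne : μH[((⟨s, htε.le⟩ : ℝ≥0) : ℝ)] (⋂ n, N n) ≠ 0 := by
    intro h0
    have h0' : μH[s] (⋂ n, N n) = 0 := h0
    rw [h0'] at hmeas
    exact ENNReal.div_ne_zero.2 ⟨hc0, hCT⟩ (le_antisymm hmeas zero_le)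
  have hfin := le_dimH_of_hausdorffMeasure_ne_zero hne
  refine le_trans (le_of_eq ?_) hfin
  rw [ENNReal.ofReal, Real.toNNReal_of_nonneg htε.le]
  rfl
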